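/- arXiv:2601.08218 — 6 statements merged into one kernel-verified Lean document; each statement's English description precedes it below -/
import Mathlib

section
/- The rank of the matrix M over the field of rational numbers equals 13 (equivalently, the kernel of M acting on ℚ^19 has dimension 6). -/
open Matrix

def M : Matrix (Fin 19) (Fin 19) ℤ :=
  !![-2,-1,1,0,0,0,0,0,0,0,0,0,0,0,0,0,0,0,0;
    -1,-2,0,1,-1,0,1,0,0,0,0,0,0,0,0,0,0,0,0;
    1,0,-2,0,0,0,0,1,0,0,0,0,0,0,0,0,0,0,0;
    0,1,0,-2,1,0,-2,0,0,0,0,0,0,0,0,0,0,0,1;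
    0,-1,0,1,-2,0,2,0,0,0,1,0,-1,0,0,0,0,0,0;
    0,0,0,0,0,0,0,0,0,0,0,0,0,0,0,0,0,0,0;
    0,1,0,-2,2,0,-4,0,0,1,-1,0,2,0,0,-1,0,0,2;
    0,0,1,0,0,0,0,-2,0,0,0,0,0,1,0,0,0,0,0;
    0,0,0,0,0,0,0,0,0,0,0,0,0,0,0,0,0,0,0;
    0,0,0,0,0,0,1,0,0,-2,0,0,-1,0,0,2,0,0,-1;
    0,0,0,0,1,0,-1,0,0,0,-2,0,2,0,0,0,0,0,0;
    0,0,0,0,0,0,0,0,0,0,0,0,0,0,0,0,0,0,0;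
    0,0,0,0,-1,0,2,0,0,-1,2,0,-4,0,0,2,0,0,-1;
    0,0,0,0,0,0,0,1,0,0,0,0,0,-2,0,0,0,0,0;
    0,0,0,0,0,0,0,0,0,0,0,0,0,0,0,0,0,0,0;
    0,0,0,0,0,0,-1,0,0,2,0,0,2,0,0,-4,0,0,2;
    0,0,0,0,0,0,0,0,0,0,0,0,0,0,0,0,0,0,0;
    0,0,0,0,0,0,0,0,0,0,0,0,0,0,0,0,0,0,0;
    0,0,0,1,0,0,2,0,0,-1,0,0,-1,0,0,2,0,0,-4]

/-- An injection of `Fin 13` onto the indices of the nonzero rows of `M`. -/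
def nonzeroIndex : Fin 13 → Fin 19 := ![0, 1, 2, 3, 4, 6, 7, 9, 10, 12, 13, 15, 18]

/-- `14` times the inverse of the principal submatrix of `M` on its nonzero rows. -/
def scaledInverse : Matrix (Fin 13) (Fin 13) ℤ :=
  !![-40,36,-30,24,-32,-24,-20,-12,-16,-12,-10,-8,-4;
    36,-45,27,-30,40,30,18,15,20,15,9,10,5;
    -30,27,-33,18,-24,-18,-22,-9,-12,-9,-11,-6,-3;
    24,-30,18,-48,36,48,12,24,18,24,6,16,8;
    -32,40,-24,36,-76,-64,-16,-32,-38,-32,-8,-26,-20;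
    -24,30,-18,48,-64,-76,-12,-38,-32,-38,-6,-30,-22;
    -20,18,-22,12,-16,-12,-24,-6,-8,-6,-12,-4,-2;
    -12,15,-9,24,-32,-38,-6,-33,-16,-19,-3,-22,-11;
    -16,20,-12,18,-38,-32,-8,-16,-40,-30,-4,-20,-10;
    -12,15,-9,24,-32,-38,-6,-19,-30,-33,-3,-22,-11;
    -10,9,-11,6,-8,-6,-12,-3,-4,-3,-13,-2,-1;
    -8,10,-6,16,-26,-30,-4,-22,-20,-22,-2,-24,-12;
    -4,5,-3,8,-20,-22,-2,-11,-10,-11,-1,-12,-13]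

theorem submatrix_mul_scaledInverse :
    M.submatrix nonzeroIndex nonzeroIndex * scaledInverse = (14 : ℤ) • 1 := by
  decide +kernel

theorem row_M_eq_zero : ∀ i ∉ Finset.univ.image nonzeroIndex, M.row i = 0 := by
  decide +kernel

theorem isUnit_submatrix_M_rat :
    IsUnit ((M.map (Int.cast : ℤ → ℚ)).submatrix nonzeroIndex nonzeroIndex) := by
  have h : (M.map (Int.cast : ℤ → ℚ)).submatrix nonzeroIndex nonzeroIndex *
      scaledInverse.map (Int.cast : ℤ → ℚ) = (14 : ℚ) • 1 := by
    have h' := congrArg (Int.castRingHom ℚ).mapMatrix submatrix_mul_scaledInverse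
    rw [map_mul, map_zsmul, map_one] at h'
    rw [← Int.cast_smul_eq_zsmul ℚ] at h'
    exact_mod_cast h'
  refine IsUnit.of_mul_eq_one ((14 : ℚ)⁻¹ • scaledInverse.map (Int.cast : ℤ → ℚ)) ?_
  rw [Matrix.mul_smul, h, smul_smul]
  norm_num

theorem rank_M_rat :
    (M.map (Int.cast : ℤ → ℚ)).rank = 13 := by
  apply le_antisymm
  · have h := (M.map (Int.cast : ℤ → ℚ)).rank_le_card_of_support_subset
      (Finset.univ.image nonzeroIndex) <| by
        rw [Function.support_subset_iff']
        intro i hi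
        ext j
        simpa using congrFun (row_M_eq_zero i (by simpa using hi)) j
    exact h.trans (Finset.card_image_le.trans (by simp))
  · have h := (M.map (Int.cast : ℤ → ℚ)).rank_submatrix_le nonzeroIndex nonzeroIndex
    rwa [Matrix.rank_of_isUnit _ isUnit_submatrix_M_rat, Fintype.card_fin] at h
end

section
/- The rank of the matrix M, with entries reduced modulo 7 (i.e., viewed as a matrix over the field ℤ/7ℤ), equals 12. -/
open Matrix

/-- Row (and column) indices of an invertible principal submatrix of `M` modulo 7. -/
def pivotIndex : Fin 12 → Fin 19 :=
  ![0, 1, 2, 3, 4, 6, 7, 9, 10, 12, 13, 15]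

/-- The nonzero rows of the reduced row echelon form of `M` modulo 7. -/
def echelonRows : Matrix (Fin 12) (Fin 19) (ZMod 7) :=
  !![1,0,0,0,0,0,0,0,0,0,0,0,0,0,0,0,0,0,4;
    0,1,0,0,0,0,0,0,0,0,0,0,0,0,0,0,0,0,2;
    0,0,1,0,0,0,0,0,0,0,0,0,0,0,0,0,0,0,3;
    0,0,0,1,0,0,0,0,0,0,0,0,0,0,0,0,0,0,6;
    0,0,0,0,1,0,0,0,0,0,0,0,0,0,0,0,0,0,6;
    0,0,0,0,0,0,1,0,0,0,0,0,0,0,0,0,0,0,1;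
    0,0,0,0,0,0,0,1,0,0,0,0,0,0,0,0,0,0,2;
    0,0,0,0,0,0,0,0,0,1,0,0,0,0,0,0,0,0,4;
    0,0,0,0,0,0,0,0,0,0,1,0,0,0,0,0,0,0,3;
    0,0,0,0,0,0,0,0,0,0,0,0,1,0,0,0,0,0,4;
    0,0,0,0,0,0,0,0,0,0,0,0,0,1,0,0,0,0,1;
    0,0,0,0,0,0,0,0,0,0,0,0,0,0,0,1,0,0,5]

/-- The inverse of the principal submatrix of `M` modulo 7 on the pivot indices. -/
def pivotInverse : Matrix (Fin 12) (Fin 12) (ZMod 7) :=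
  !![1,3,6,1,3,2,4,1,5,1,2,4;
    3,5,4,4,5,1,5,4,6,4,6,2;
    6,4,2,6,4,5,6,6,2,6,3,3;
    1,4,6,5,6,3,4,5,3,5,2,6;
    3,5,4,6,0,0,5,0,0,0,6,0;
    2,1,5,3,0,1,1,4,0,4,4,2;
    4,5,6,4,5,1,1,4,6,4,4,2;
    1,4,6,5,0,4,4,1,0,2,2,4;
    5,6,2,3,0,0,6,0,2,6,3,3;
    1,4,6,5,0,4,4,2,6,1,2,4;
    2,6,3,2,6,4,4,2,3,2,5,1;
    4,2,3,6,0,2,2,4,3,4,1,5]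

theorem M_mod7_eq_mul_echelonRows :
    M.map (Int.cast : ℤ → ZMod 7) =
      (M.map (Int.cast : ℤ → ZMod 7)).submatrix id pivotIndex * echelonRows := by
  decide +kernel

theorem pivot_submatrix_mul_pivotInverse :
    (M.map (Int.cast : ℤ → ZMod 7)).submatrix pivotIndex pivotIndex * pivotInverse = 1 := by
  decide +kernel

theorem rank_M_mod7 :
    (M.map (Int.cast : ℤ → ZMod 7)).rank = 12 := by
  have : Fact (Nat.Prime 7) := ⟨by norm_num⟩
  apply le_antisymm
  · rw [M_mod7_eq_mul_echelonRows]
    exact (rank_mul_le_right _ _).trans (rank_le_height _)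
  · have h := rank_mul_le_left
      ((M.map (Int.cast : ℤ → ZMod 7)).submatrix pivotIndex pivotIndex) pivotInverse
    rw [pivot_submatrix_mul_pivotInverse, rank_one, Fintype.card_fin] at h
    exact h.trans (rank_submatrix_le _ _ _)
end

section
/- The rank of the matrix M, with entries reduced modulo 2 (i.e., viewed as a matrix over the field ℤ/2ℤ), equals 12. -/
open Matrix

/-- Indices of a maximal linearly independent set of rows of `M` modulo 2. -/
def basisIndex : Fin 12 → Fin 19 :=
  ![0,2,3,4,6,7,9,10,12,13,15,18]

/-- Coefficients expressing every row of `M` modulo 2 through the rows in `basisIndex`. -/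
def rowCoeff : Matrix (Fin 19) (Fin 12) (ZMod 2) :=
  !![1,0,0,0,0,0,0,0,0,0,0,0;
    0,1,0,0,0,0,1,0,1,1,0,1;
    0,1,0,0,0,0,0,0,0,0,0,0;
    0,0,1,0,0,0,0,0,0,0,0,0;
    0,0,0,1,0,0,0,0,0,0,0,0;
    0,0,0,0,0,0,0,0,0,0,0,0;
    0,0,0,0,1,0,0,0,0,0,0,0;
    0,0,0,0,0,1,0,0,0,0,0,0;
    0,0,0,0,0,0,0,0,0,0,0,0;
    0,0,0,0,0,0,1,0,0,0,0,0;
    0,0,0,0,0,0,0,1,0,0,0,0;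
    0,0,0,0,0,0,0,0,0,0,0,0;
    0,0,0,0,0,0,0,0,1,0,0,0;
    0,0,0,0,0,0,0,0,0,1,0,0;
    0,0,0,0,0,0,0,0,0,0,0,0;
    0,0,0,0,0,0,0,0,0,0,1,0;
    0,0,0,0,0,0,0,0,0,0,0,0;
    0,0,0,0,0,0,0,0,0,0,0,0;
    0,0,0,0,0,0,0,0,0,0,0,1]

/-- The inverse modulo 2 of the principal submatrix of `M` on `basisIndex`. -/
def minorInverse : Matrix (Fin 12) (Fin 12) (ZMod 2) :=
  !![0,1,0,0,0,0,0,0,0,1,0,0;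
    1,0,0,0,0,0,0,0,0,0,0,0;
    0,0,0,0,0,0,1,1,1,0,0,1;
    0,0,0,0,0,0,0,1,0,0,1,0;
    0,0,0,0,0,0,0,0,0,0,1,0;
    0,0,0,0,0,0,0,0,0,1,0,0;
    0,0,1,0,0,0,0,0,1,0,0,0;
    0,0,1,1,0,0,0,0,1,0,0,1;
    0,0,1,0,0,0,1,1,0,0,0,0;
    1,0,0,0,0,1,0,0,0,0,0,0;
    0,0,0,1,1,0,0,0,0,0,0,1;
    0,0,1,0,0,0,0,1,0,0,1,0]

theorem rowCoeff_mul_submatrix :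
    rowCoeff * (M.map (Int.cast : ℤ → ZMod 2)).submatrix basisIndex id =
      M.map (Int.cast : ℤ → ZMod 2) := by
  decide +kernel

theorem submatrix_mul_minorInverse :
    (M.map (Int.cast : ℤ → ZMod 2)).submatrix basisIndex basisIndex * minorInverse = 1 := by
  decide +kernel

theorem rank_M_mod2 :
    (M.map (Int.cast : ℤ → ZMod 2)).rank = 12 := by
  apply le_antisymm
  · rw [← rowCoeff_mul_submatrix]
    exact (rank_mul_le_left _ _).trans (rank_le_width _)
  · calc 12 = (1 : Matrix (Fin 12) (Fin 12) (ZMod 2)).rank := by simp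
      _ ≤ ((M.map (Int.cast : ℤ → ZMod 2)).submatrix basisIndex basisIndex).rank := by
        rw [← submatrix_mul_minorInverse]
        exact rank_mul_le_left _ _
      _ ≤ _ := rank_submatrix_le _ _ _
end

section
/- There exist matrices U and V in GL(19, ℤ) (i.e., 19×19 integer matrices invertible over ℤ) such that U · M · V is the diagonal matrix with diagonal entries d₁ = d₂ = ⋯ = d₁₂ = 1, d₁₃ = 14, and d₁₄ = ⋯ = d₁₉ = 0. In other words, the elementary divisors (Smith normal form invariants) of M are 1 with multiplicity 12, 14 with multiplicity 1, and 0 with multiplicity 6. -/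
open Matrix

/-- Row operations bringing `M` to Smith normal form. -/
def rowTransform : Matrix (Fin 19) (Fin 19) ℤ :=
  !![0,0,0,0,0,0,0,1,0,0,0,0,0,0,0,0,0,0,0;
    0,0,1,0,0,0,0,0,0,0,0,0,0,0,0,0,0,0,0;
    1,0,0,0,0,0,0,0,0,0,0,0,0,0,0,0,0,0,0;
    0,-1,0,0,0,0,0,0,0,0,0,0,0,0,0,0,0,0,0;
    0,0,0,1,0,0,0,0,0,0,0,0,0,0,0,0,0,0,0;
    0,0,0,-1,-1,0,0,0,0,0,0,0,0,0,0,0,0,0,0;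
    0,0,0,0,0,0,0,0,0,0,1,0,0,0,0,0,0,0,0;
    0,0,0,-1,0,0,1,0,0,0,-1,0,0,0,0,0,0,0,0;
    0,0,0,0,1,0,1,0,0,0,0,0,0,0,0,0,0,0,1;
    0,0,0,0,-2,0,-2,0,0,1,0,0,0,0,0,0,0,0,-2;
    0,0,0,0,0,0,0,0,0,-1,1,0,1,0,0,0,0,0,0;
    0,0,0,0,2,0,2,0,0,1,0,0,0,0,0,1,0,0,2;
    -4,5,-3,8,-20,0,-22,-2,0,-11,-10,0,-11,-1,0,-12,0,0,-13;
    0,0,0,0,0,1,0,0,0,0,0,0,0,0,0,0,0,0,0;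
    0,0,0,0,0,0,0,0,0,0,0,0,0,0,1,0,0,0,0;
    0,0,0,0,0,0,0,0,0,0,0,1,0,0,0,0,0,0,0;
    0,0,0,0,0,0,0,0,0,0,0,0,0,0,0,0,1,0,0;
    0,0,0,0,0,0,0,0,0,0,0,0,0,0,0,0,0,1,0;
    0,0,0,0,0,0,0,0,1,0,0,0,0,0,0,0,0,0,0]

/-- The inverse of `rowTransform`. -/
def rowTransformInv : Matrix (Fin 19) (Fin 19) ℤ :=
  !![0,0,1,0,0,0,0,0,0,0,0,0,0,0,0,0,0,0,0;
    0,0,0,-1,0,0,0,0,0,0,0,0,0,0,0,0,0,0,0;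
    0,1,0,0,0,0,0,0,0,0,0,0,0,0,0,0,0,0,0;
    0,0,0,0,1,0,0,0,0,0,0,0,0,0,0,0,0,0,0;
    0,0,0,0,-1,-1,0,0,0,0,0,0,0,0,0,0,0,0,0;
    0,0,0,0,0,0,0,0,0,0,0,0,0,1,0,0,0,0,0;
    0,0,0,0,1,0,1,1,0,0,0,0,0,0,0,0,0,0,0;
    1,0,0,0,0,0,0,0,0,0,0,0,0,0,0,0,0,0,0;
    0,0,0,0,0,0,0,0,0,0,0,0,0,0,0,0,0,0,1;
    0,0,0,0,0,0,0,0,2,1,0,0,0,0,0,0,0,0,0;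
    0,0,0,0,0,0,1,0,0,0,0,0,0,0,0,0,0,0,0;
    0,0,0,0,0,0,0,0,0,0,0,0,0,0,0,1,0,0,0;
    0,0,0,0,0,0,-1,0,2,1,1,0,0,0,0,0,0,0,0;
    -2,-3,-4,-5,6,7,-8,-9,-9,-10,-11,-12,-1,0,0,0,0,0,0;
    0,0,0,0,0,0,0,0,0,0,0,0,0,0,1,0,0,0,0;
    0,0,0,0,0,0,0,0,-4,-1,0,1,0,0,0,0,0,0,0;
    0,0,0,0,0,0,0,0,0,0,0,0,0,0,0,0,1,0,0;
    0,0,0,0,0,0,0,0,0,0,0,0,0,0,0,0,0,1,0;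
    0,0,0,0,0,1,-1,-1,1,0,0,0,0,0,0,0,0,0,0]

/-- Column operations bringing `M` to Smith normal form. -/
def colTransform : Matrix (Fin 19) (Fin 19) ℤ :=
  !![0,0,0,1,-2,-3,4,5,5,6,7,8,10,0,0,0,0,0,0;
    0,0,0,0,1,2,-3,-4,-4,-5,-6,-7,-9,0,0,0,0,0,0;
    0,0,1,2,-3,-4,5,6,6,7,8,9,11,0,0,0,0,0,0;
    0,0,0,0,0,1,-1,-1,-1,-2,-3,-4,-6,0,0,0,0,0,0;
    0,0,0,0,0,0,1,2,2,3,4,5,8,0,0,0,0,0,0;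
    0,0,0,0,0,0,0,0,0,0,0,0,0,1,0,0,0,0,0;
    0,0,0,0,0,0,0,0,0,1,2,3,6,0,0,0,0,0,0;
    0,1,2,3,-4,-5,6,7,7,8,9,10,12,0,0,0,0,0,0;
    0,0,0,0,0,0,0,0,0,0,0,0,0,0,0,1,0,0,0;
    0,0,0,0,0,0,0,0,0,0,1,1,3,0,0,0,0,0,0;
    0,0,0,0,0,0,0,1,1,1,1,2,4,0,0,0,0,0,0;
    0,0,0,0,0,0,0,0,0,0,0,0,0,0,0,0,0,0,1;
    0,0,0,0,0,0,0,0,0,0,0,1,3,0,0,0,0,0,0;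
    1,2,3,4,-5,-6,7,8,8,9,10,11,13,0,0,0,0,0,0;
    0,0,0,0,0,0,0,0,0,0,0,0,0,0,1,0,0,0,0;
    0,0,0,0,0,0,0,0,1,0,0,0,2,0,0,0,0,0,0;
    0,0,0,0,0,0,0,0,0,0,0,0,0,0,0,0,1,0,0;
    0,0,0,0,0,0,0,0,0,0,0,0,0,0,0,0,0,1,0;
    0,0,0,0,0,0,0,0,0,0,0,0,1,0,0,0,0,0,0]

/-- The inverse of `colTransform`. -/
def colTransformInv : Matrix (Fin 19) (Fin 19) ℤ :=
  !![0,0,1,0,0,0,0,-2,0,0,0,0,0,1,0,0,0,0,0;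
    1,0,-2,0,0,0,0,1,0,0,0,0,0,0,0,0,0,0,0;
    -2,-1,1,0,0,0,0,0,0,0,0,0,0,0,0,0,0,0,0;
    1,2,0,-1,1,0,-1,0,0,0,0,0,0,0,0,0,0,0,0;
    0,1,0,-2,1,0,-2,0,0,0,0,0,0,0,0,0,0,0,1;
    0,0,0,1,1,0,0,0,0,0,-1,0,1,0,0,0,0,0,-1;
    0,0,0,0,1,0,-1,0,0,0,-2,0,2,0,0,0,0,0,0;
    0,0,0,0,0,0,-1,0,0,1,1,0,0,0,0,-1,0,0,1;
    0,0,0,0,0,0,0,0,0,0,0,0,0,0,0,1,0,0,-2;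
    0,0,0,0,0,0,1,0,0,-2,0,0,-1,0,0,0,0,0,3;
    0,0,0,0,0,0,0,0,0,1,0,0,-1,0,0,0,0,0,0;
    0,0,0,0,0,0,0,0,0,0,0,0,1,0,0,0,0,0,-3;
    0,0,0,0,0,0,0,0,0,0,0,0,0,0,0,0,0,0,1;
    0,0,0,0,0,1,0,0,0,0,0,0,0,0,0,0,0,0,0;
    0,0,0,0,0,0,0,0,0,0,0,0,0,0,1,0,0,0,0;
    0,0,0,0,0,0,0,0,1,0,0,0,0,0,0,0,0,0,0;
    0,0,0,0,0,0,0,0,0,0,0,0,0,0,0,0,1,0,0;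
    0,0,0,0,0,0,0,0,0,0,0,0,0,0,0,0,0,1,0;
    0,0,0,0,0,0,0,0,0,0,0,1,0,0,0,0,0,0,0]

theorem rowTransform_mul_inv :
    rowTransform * rowTransformInv = 1 := by
  decide +kernel

theorem colTransform_mul_inv :
    colTransform * colTransformInv = 1 := by
  decide +kernel

/-- The elementary divisors of `M`. -/
def elementaryDivisors (i : Fin 19) : ℤ :=
  if (i : ℕ) < 12 then 1 else if (i : ℕ) = 12 then 14 else 0

theorem rowTransform_mul_M :
    rowTransform * M = Matrix.diagonal elementaryDivisors * colTransformInv := by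
  decide +kernel

theorem smith_normal_form_M :
    ∃ U V : GL (Fin 19) ℤ,
      (U : Matrix (Fin 19) (Fin 19) ℤ) * M * (V : Matrix (Fin 19) (Fin 19) ℤ) =
        Matrix.diagonal (fun i : Fin 19 =>
          if (i : ℕ) < 12 then 1 else if (i : ℕ) = 12 then 14 else 0) := by
  refine ⟨⟨rowTransform, rowTransformInv, rowTransform_mul_inv,
      mul_eq_one_comm.mp rowTransform_mul_inv⟩,
    ⟨colTransform, colTransformInv, colTransform_mul_inv,
      mul_eq_one_comm.mp colTransform_mul_inv⟩, ?_⟩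
  change rowTransform * M * colTransform = Matrix.diagonal elementaryDivisors
  rw [rowTransform_mul_M, Matrix.mul_assoc, mul_eq_one_comm.mp colTransform_mul_inv,
    Matrix.mul_one]
end

section
/- The cokernel of the ℤ-linear map ℤ^19 → ℤ^19 given by multiplication by the matrix M is isomorphic, as a ℤ-module, to (ℤ/14ℤ) × ℤ^6. -/
open Matrix

/-- The indices of the zero rows of `M`. -/
def zeroRow : Fin 6 → Fin 19 := ![5, 8, 11, 14, 16, 17]

/-- A covector whose product with `M` is divisible by `14`. -/
def torsionCovector : Fin 19 → ℤ :=
  ![-6, -3, -1, -2, -2, 0, 2, 4, 0, 1, 6, 0, 1, -5, 0, -4, 0, 0, 5]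

/-- The quotient of `torsionCovector ᵥ* M` by `14`. -/
def torsionCovectorQuotient : Fin 19 → ℤ :=
  ![1, 1, 0, 0, 1, 0, 0, -1, 0, -1, -1, 0, 0, 1, 0, 2, 0, 0, -2]

/-- A vector whose image under `M` is divisible by `14`. -/
def torsionVector : Fin 19 → ℤ :=
  ![2, 1, 5, -4, -4, 0, 4, -6, 0, -5, -2, 0, -5, -3, 0, 6, 0, 0, 3]

/-- The quotient of `M *ᵥ torsionVector` by `14`. -/
def torsionVectorQuotient : Fin 19 → ℤ :=
  ![0, 0, -1, 0, 1, 0, -2, 1, 0, 2, -1, 0, 3, 0, 0, -3, 0, 0, 1]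

/-- An inverse of `M` on its nonzero rows, up to a correction of rank one. -/
def partialInverse : Matrix (Fin 19) (Fin 19) ℤ :=
  !![-2,3,-2,2,-2,0,-2,-2,0,-1,-2,0,-1,0,0,0,0,0,-1;
    3,-3,2,-2,3,0,2,1,0,1,1,0,1,1,0,1,0,0,0;
    0,3,-2,2,-1,0,-2,-3,0,-1,-3,0,-1,1,0,1,0,0,-2;
    0,-3,1,-4,2,0,4,2,0,2,3,0,2,-1,0,0,0,0,2;
    -4,2,-2,2,-6,0,-4,0,0,-2,-1,0,-2,-2,0,-3,0,0,0;
    0,0,0,0,0,0,0,0,0,0,0,0,0,0,0,0,0,0,0;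
    0,3,-1,4,-4,0,-6,-2,0,-3,-4,0,-3,1,0,-1,0,0,-3;
    -4,0,-2,0,-2,0,0,0,0,0,2,0,0,-3,0,-2,0,0,2;
    0,0,0,0,0,0,0,0,0,0,0,0,0,0,0,0,0,0,0;
    -3,0,-1,1,-3,0,-2,1,0,-2,1,0,-1,-2,0,-3,0,0,1;
    -2,1,-1,1,-3,0,-2,0,0,-1,-2,0,-2,-1,0,-2,0,0,0;
    0,0,0,0,0,0,0,0,0,0,0,0,0,0,0,0,0,0,0;
    -3,0,-1,1,-3,0,-2,1,0,-1,0,0,-2,-2,0,-3,0,0,1;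
    -2,0,-1,0,-1,0,0,0,0,0,1,0,0,-2,0,-1,0,0,1;
    0,0,0,0,0,0,0,0,0,0,0,0,0,0,0,0,0,0,0;
    2,2,0,2,-1,0,-3,-2,0,-2,-4,0,-2,2,0,0,0,0,-3;
    0,0,0,0,0,0,0,0,0,0,0,0,0,0,0,0,0,0,0;
    0,0,0,0,0,0,0,0,0,0,0,0,0,0,0,0,0,0,0;
    1,1,0,1,-1,0,-2,-1,0,-1,-2,0,-1,1,0,0,0,0,-2]

theorem M_zeroRow : M.submatrix zeroRow id = 0 := by
  decide +kernel

theorem torsionCovector_vecMul_M :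
    torsionCovector ᵥ* M = (14 : ℤ) • torsionCovectorQuotient := by
  decide +kernel

theorem M_mulVec_torsionVector :
    M *ᵥ torsionVector = (14 : ℤ) • torsionVectorQuotient := by
  decide +kernel

theorem M_mul_partialInverse_add :
    M * partialInverse + vecMulVec torsionVectorQuotient torsionCovector =
      diagonal fun i => if ∃ k, zeroRow k = i then 0 else 1 := by
  decide +kernel

/-- The map that pairs with `torsionCovector` modulo `14` and reads off the coordinates at the
zero rows of `M`. -/
def cokernelMap : (Fin 19 → ℤ) →ₗ[ℤ] ZMod 14 × (Fin 6 → ℤ) :=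
  ((Int.castAddHom (ZMod 14)).toIntLinearMap ∘ₗ dotProductBilin ℤ ℤ torsionCovector).prod
    (LinearMap.funLeft ℤ ℤ zeroRow)

theorem cokernelMap_apply (x : Fin 19 → ℤ) :
    cokernelMap x = (((torsionCovector ⬝ᵥ x : ℤ) : ZMod 14), x ∘ zeroRow) :=
  rfl

theorem range_M_le_ker : LinearMap.range M.mulVecLin ≤ LinearMap.ker cokernelMap := by
  rintro _ ⟨y, rfl⟩
  rw [LinearMap.mem_ker, cokernelMap_apply, mulVecLin_apply, Prod.mk_eq_zero]
  constructor
  · rw [dotProduct_mulVec, torsionCovector_vecMul_M, smul_dotProduct,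
      ZMod.intCast_zmod_eq_zero_iff_dvd]
    exact dvd_mul_right _ _
  · change M.submatrix zeroRow id *ᵥ y = 0
    rw [M_zeroRow, zero_mulVec]

theorem ker_le_range_M : LinearMap.ker cokernelMap ≤ LinearMap.range M.mulVecLin := by
  intro x hx
  rw [LinearMap.mem_ker, cokernelMap_apply, Prod.mk_eq_zero,
    ZMod.intCast_zmod_eq_zero_iff_dvd] at hx
  obtain ⟨⟨t, ht⟩, h0⟩ := hx
  refine ⟨partialInverse *ᵥ x + t • torsionVector, ?_⟩
  have hD : (diagonal fun i => if ∃ k, zeroRow k = i then (0 : ℤ) else 1) *ᵥ x = x := by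
    ext i
    rw [mulVec_diagonal]
    split_ifs with h
    · obtain ⟨k, rfl⟩ := h
      rw [zero_mul]
      exact (congrFun h0 k).symm
    · exact one_mul _
  rw [← M_mul_partialInverse_add, add_mulVec, vecMulVec_mulVec, ht] at hD
  rw [mulVecLin_apply, mulVec_add, mulVec_smul, mulVec_mulVec, M_mulVec_torsionVector]
  refine Eq.trans ?_ hD
  ext i
  simp
  ring

theorem cokernelMap_surjective : Function.Surjective cokernelMap := by
  rintro ⟨a, b⟩
  obtain ⟨n, rfl⟩ := ZMod.intCast_surjective a
  refine ⟨![0, 0, 0, 0, 0, b 0, 0, 0, b 1, 0, 0, b 2, n, 0, b 3, 0, b 4, b 5, 0], ?_⟩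
  rw [cokernelMap_apply, Prod.mk.injEq]
  constructor
  · simp [torsionCovector, dotProduct, Fin.sum_univ_succ]
  · ext k
    fin_cases k <;> rfl

theorem cokernel_M :
    Nonempty (((Fin 19 → ℤ) ⧸ LinearMap.range M.mulVecLin) ≃ₗ[ℤ]
      ZMod 14 × (Fin 6 → ℤ)) := by
  rw [le_antisymm range_M_le_ker ker_le_range_M]
  exact ⟨cokernelMap.quotKerEquivOfSurjective cokernelMap_surjective⟩
end

section
/- The greatest common divisor of the determinants of all 13×13 submatrices of M (over all injective functions f, g : Fin 13 → Fin 19 selecting rows and columns) equals 14. In particular, 14 divides every 13×13 minor of M, and not every 13×13 minor of M is divisible by any integer larger than 14. -/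
open Matrix

theorem Matrix.det_submatrix_eq_mul_of_rows_zero {R ι m n : Type*} [CommRing R]
    [Fintype n] [DecidableEq n] [DecidableEq m] (A : Matrix m ι R) (e : n → m)
    (he : Function.Injective e) (hA : ∀ i, i ∉ Set.range e → A i = 0) (f : n → m) (g : n → ι) :
    (A.submatrix f g).det =
      (of fun i k => if e k = f i then (1 : R) else 0).det * (A.submatrix e g).det := by
  rw [← det_mul]
  congr 1
  ext i j
  simp only [submatrix_apply, mul_apply, of_apply, ite_mul, one_mul, zero_mul]
  by_cases h : f i ∈ Set.range e
  · obtain ⟨k, hk⟩ := h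
    simp [← hk, he.eq_iff]
  · have h' : ∀ k, e k ≠ f i := fun k hk => h ⟨k, hk⟩
    simp [h', hA _ h]

/-- If all entries outside the rows `e` and the columns `e'` vanish, then every minor of the same
size is a multiple of the minor selected by `e` and `e'`. -/
theorem Matrix.det_submatrix_dvd_of_support {R m l n : Type*} [CommRing R]
    [Fintype n] [DecidableEq n] [DecidableEq m] [DecidableEq l] (A : Matrix m l R)
    (e : n ↪ m) (e' : n ↪ l) (hrow : ∀ i, i ∉ Set.range e → A i = 0)
    (hcol : ∀ j, j ∉ Set.range e' → Aᵀ j = 0) (f : n → m) (g : n → l) :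
    (A.submatrix e e').det ∣ (A.submatrix f g).det := by
  rw [det_submatrix_eq_mul_of_rows_zero A e e.injective hrow f g, ← det_transpose (A.submatrix e g),
    transpose_submatrix, det_submatrix_eq_mul_of_rows_zero Aᵀ e' e'.injective hcol g e,
    ← transpose_submatrix, det_transpose]
  exact dvd_mul_of_dvd_right (dvd_mul_left _ _) _

/-- If all entries outside the rows `e` and the columns `e'` vanish, then the minor selected by
`e` and `e'` is, up to normalization, the gcd of all minors of that size. -/
theorem Matrix.gcd_minors_eq_normalize_of_support {R m l n : Type*} [CommRing R] [IsDomain R]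
    [NormalizedGCDMonoid R] [Fintype n] [DecidableEq n] [DecidableEq m] [DecidableEq l]
    [Fintype (n ↪ m)] [Fintype (n ↪ l)] (A : Matrix m l R)
    (e : n ↪ m) (e' : n ↪ l) (hrow : ∀ i, i ∉ Set.range e → A i = 0)
    (hcol : ∀ j, j ∉ Set.range e' → Aᵀ j = 0) :
    Finset.univ.gcd (fun fg : (n ↪ m) × (n ↪ l) => (A.submatrix fg.1 fg.2).det) =
      normalize (A.submatrix e e').det := by
  rw [← Finset.normalize_gcd]
  exact normalize_eq_normalize
    (Finset.gcd_dvd (f := fun fg : (n ↪ m) × (n ↪ l) => (A.submatrix fg.1 fg.2).det)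
      (Finset.mem_univ (e, e')))
    (Finset.dvd_gcd fun fg _ => det_submatrix_dvd_of_support A e e' hrow hcol fg.1 fg.2)

/-- The nonzero rows of `M`, in a pivoting order. -/
def pivotRows : Fin 13 ↪ Fin 19 :=
  ⟨![3, 4, 13, 9, 6, 12, 2, 15, 7, 0, 1, 10, 18], by decide⟩

/-- The nonzero columns of `M`, in a pivoting order. -/
def pivotCols : Fin 13 ↪ Fin 19 :=
  ⟨![1, 10, 7, 12, 18, 4, 0, 6, 2, 9, 15, 3, 13], by decide⟩

/-- The lower triangular factor of the pivoted nonzero block of `M`. -/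
def lowerFactor : Matrix (Fin 13) (Fin 13) ℤ :=
  !![1, 0, 0, 0, 0, 0, 0, 0, 0, 0, 0, 0, 0;
    -1, 1, 0, 0, 0, 0, 0, 0, 0, 0, 0, 0, 0;
    0, 0, 1, 0, 0, 0, 0, 0, 0, 0, 0, 0, 0;
    0, 0, 0, 1, 0, 0, 0, 0, 0, 0, 0, 0, 0;
    1, -1, 0, -1, 1, 0, 0, 0, 0, 0, 0, 0, 0;
    0, 2, 0, 2, -1, 1, 0, 0, 0, 0, 0, 0, 0;
    0, 0, 1, 0, 0, 0, 1, 0, 0, 0, 0, 0, 0;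
    0, 0, 0, -2, 0, 0, 0, 1, 0, 0, 0, 0, 0;
    0, 0, -2, 0, 0, 0, 0, 0, 1, 0, 0, 0, 0;
    -1, 0, 0, 0, 1, 1, -2, 0, -3, 1, 0, 0, 0;
    -2, 0, 0, 0, 2, 1, -1, 0, -2, 0, 1, 0, 0;
    0, -2, 0, 0, 2, -1, 0, 0, 0, -4, 3, 1, 0;
    0, 0, 0, 1, -3, 0, 0, -2, 0, 6, -3, -4, 1]

/-- The upper triangular factor of the pivoted nonzero block of `M`. -/
def upperFactor : Matrix (Fin 13) (Fin 13) ℤ :=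
  !![1, 0, 0, 0, 1, 1, 0, -2, 0, 0, 0, -2, 0;
    0, 1, 0, -1, 1, -1, 0, 0, 0, 0, 0, -1, 0;
    0, 0, 1, 0, 0, 0, 0, 0, 0, 0, 0, 0, -2;
    0, 0, 0, -1, -1, 0, 0, 1, 0, -2, 2, 0, 0;
    0, 0, 0, 0, 1, 0, 0, -1, 0, -1, 1, -1, 0;
    0, 0, 0, 0, 0, 1, 0, -1, 0, 2, -1, 1, 0;
    0, 0, 0, 0, 0, 0, 1, 0, -2, 0, 0, 0, 2;
    0, 0, 0, 0, 0, 0, 0, 1, 0, -2, 0, 0, 0;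
    0, 0, 0, 0, 0, 0, 0, 0, 1, 0, 0, 0, -3;
    0, 0, 0, 0, 0, 0, 0, 0, 0, -1, 0, -2, -5;
    0, 0, 0, 0, 0, 0, 0, 0, 0, 0, -1, -2, -4;
    0, 0, 0, 0, 0, 0, 0, 0, 0, 0, 0, -1, -8;
    0, 0, 0, 0, 0, 0, 0, 0, 0, 0, 0, 0, -14]

theorem M_submatrix_pivots :
    M.submatrix pivotRows pivotCols = lowerFactor * upperFactor := by
  decide +kernel

theorem det_lowerFactor : lowerFactor.det = 1 := by
  have h₀ : ∀ p : Fin 13 × Fin 13, p.1 < p.2 → lowerFactor p.1 p.2 = 0 := by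
    decide +kernel
  have h : lowerFactor.IsLowerTriangular := fun i j hij => h₀ (i, j) hij
  rw [det_of_isLowerTriangular _ h]
  decide +kernel

theorem normalize_det_upperFactor : normalize upperFactor.det = 14 := by
  have h₀ : ∀ p : Fin 13 × Fin 13, p.2 < p.1 → upperFactor p.1 p.2 = 0 := by
    decide +kernel
  have h : upperFactor.IsUpperTriangular := fun i j hij => h₀ (i, j) hij
  have h' : upperFactor.det = -14 := by
    rw [det_of_isUpperTriangular h]
    decide +kernel
  rw [h']
  decide +kernel

theorem M_row_eq_zero (i : Fin 19) (hi : i ∉ Set.range pivotRows) : M i = 0 := by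
  have h : ∀ p : Fin 19 × Fin 19, (¬∃ k, pivotRows k = p.1) → M p.1 p.2 = 0 := by
    decide +kernel
  exact funext fun j => h (i, j) hi

theorem M_col_eq_zero (j : Fin 19) (hj : j ∉ Set.range pivotCols) : Mᵀ j = 0 := by
  have h : ∀ p : Fin 19 × Fin 19, (¬∃ k, pivotCols k = p.2) → M p.1 p.2 = 0 := by
    decide +kernel
  exact funext fun i => h (i, j) hj

theorem gcd_minors13 :
    Finset.univ.gcd
      (fun fg : (Fin 13 ↪ Fin 19) × (Fin 13 ↪ Fin 19) =>
        (M.submatrix fg.1 fg.2).det) = 14 := by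
  rw [gcd_minors_eq_normalize_of_support M pivotRows pivotCols M_row_eq_zero M_col_eq_zero,
    M_submatrix_pivots, det_mul, det_lowerFactor, one_mul, normalize_det_upperFactor]
end
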